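/- arXiv:2405.14395 — 2 statements merged into one kernel-verified Lean document; each statement's English description precedes it below -/
import Mathlib

section
/- Let {s_i}_{i∈ℤ} be the bi-infinite Luo sequence generated by distinct s₀, s₁ ∈ S, and let m be the common number of factors in Luo's decomposition (the unique m ≥ 1 with w'₀ w_S = (w'₀w₁)⋯(w'_{m−1}w_m) and additive lengths, where w_i = w_{S∖{s_i}}, w'_i = w_{S∖{s_i,s_{i+1}}}). Then for every i ∈ ℤ, conjugation by the longest element satisfies w_S⁻¹ s_i w_S = s_{i+m}. In particular 2m is a period of the sequence {s_i}. -/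
namespace Luo

open CoxeterSystem List

variable {B W : Type*} [Group W] {M : CoxeterMatrix B} (cs : CoxeterSystem M W)

open Classical in
/-- The signed permutation attached to a simple reflection. -/
noncomputable def sg (i : B) : Equiv.Perm (W × ZMod 2) where
  toFun p := (cs.simple i * p.1 * cs.simple i, p.2 + if p.1 = cs.simple i then 1 else 0)
  invFun p := (cs.simple i * p.1 * cs.simple i, p.2 + if p.1 = cs.simple i then 1 else 0)
  left_inv p := by
    rcases p with ⟨t, e⟩
    have h : cs.simple i * t * cs.simple i = cs.simple i ↔ t = cs.simple i := by
      constructor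
      · intro h
        have := congrArg (fun x => cs.simple i * x * cs.simple i) h
        simpa [mul_assoc] using this
      · rintro rfl; simp
    ext
    · simp [mul_assoc]
    · simp only [h]; rw [add_assoc, CharTwo.add_self_eq_zero, add_zero]
  right_inv p := by
    rcases p with ⟨t, e⟩
    have h : cs.simple i * t * cs.simple i = cs.simple i ↔ t = cs.simple i := by
      constructor
      · intro h
        have := congrArg (fun x => cs.simple i * x * cs.simple i) h
        simpa [mul_assoc] using this
      · rintro rfl; simp
    ext
    · simp [mul_assoc]
    · simp only [h]; rw [add_assoc, CharTwo.add_self_eq_zero, add_zero]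

lemma conj_pow_eq {G : Type*} [Group G] (a b : G) (ha : a * a = 1) (hb : b * b = 1) (l : ℕ) :
    b * (a * b) ^ l = ((a * b) ^ l)⁻¹ * b := by
  have h : b * (a * b) * b⁻¹ = (a * b)⁻¹ := by
    rw [mul_inv_rev, inv_eq_of_mul_eq_one_left ha, inv_eq_of_mul_eq_one_left hb, mul_assoc,
      mul_assoc, hb, mul_one]
  have h2 : b * (a * b) ^ l * b⁻¹ = ((a * b) ^ l)⁻¹ := by
    rw [← conj_pow, h, inv_pow]
  rw [← h2]; group

open Classical in
lemma sg_pow (i j : B) (k : ℕ) (t : W) (e : ZMod 2) :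
    ((sg cs i * sg cs j) ^ k) (t, e) =
      ((cs.simple i * cs.simple j) ^ k * t * ((cs.simple i * cs.simple j) ^ k)⁻¹,
        e + ∑ n ∈ Finset.range (2 * k),
          if t = cs.simple j * (cs.simple i * cs.simple j) ^ n then 1 else 0) := by
  induction k with
  | zero => simp
  | succ k ih =>
    rw [pow_succ', Equiv.Perm.mul_apply, ih, Equiv.Perm.mul_apply]
    set a := cs.simple i with ha
    set b := cs.simple j with hb
    have haa : a * a = 1 := by simp [ha]
    have hbb : b * b = 1 := by simp [hb]
    set x := a * b with hx
    have hxi : x⁻¹ = b * a := by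
      rw [hx, mul_inv_rev, inv_eq_of_mul_eq_one_left haa, inv_eq_of_mul_eq_one_left hbb]
    have hk := conj_pow_eq a b haa hbb k
    rw [← hx] at hk
    have e1 : x ^ k * t * (x ^ k)⁻¹ = b ↔ t = b * x ^ (2 * k) := by
      rw [two_mul, pow_add, ← mul_assoc, hk]
      constructor
      · intro h; rw [← h]; group
      · intro h; rw [h]; group
    have e2 : b * (x ^ k * t * (x ^ k)⁻¹) * b = a ↔ t = b * x ^ (2 * k + 1) := by
      have : b * x ^ (2 * k + 1) = (x ^ k)⁻¹ * (b * a * b) * x ^ k := by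
        rw [show 2 * k + 1 = k + (1 + k) by ring, pow_add, ← mul_assoc, hk, pow_add, pow_one]
        rw [show (x ^ k)⁻¹ * b * (x * x ^ k) = (x ^ k)⁻¹ * (b * x) * x ^ k by group]
        rw [hx, ← mul_assoc b a b]
      rw [this]
      constructor
      · intro h; rw [← h]
        have : b * (b * (x ^ k * t * (x ^ k)⁻¹) * b) * b = x ^ k * t * (x ^ k)⁻¹ := by
          rw [show b * (b * (x ^ k * t * (x ^ k)⁻¹) * b) * b
            = (b * b) * (x ^ k * t * (x ^ k)⁻¹) * (b * b) by group, hbb]; simp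
        rw [this]; group
      · intro h; rw [h]
        have : b * (x ^ k * ((x ^ k)⁻¹ * (b * a * b) * x ^ k) * (x ^ k)⁻¹) * b
          = (b * b) * a * (b * b) := by group
        rw [this, hbb]; simp
    ext
    · simp only [sg, Equiv.coe_fn_mk, ← ha, ← hb]
      rw [pow_succ' x k, mul_inv_rev, hxi, hx]; group
    · simp only [sg, Equiv.coe_fn_mk, ← ha, ← hb]
      rw [show 2 * (k + 1) = 2 * k + 1 + 1 by ring, Finset.sum_range_succ, Finset.sum_range_succ]
      simp only [e1, e2, add_assoc]

lemma sg_liftable : M.IsLiftable (sg cs) := by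
  classical
  intro i j
  ext1 ⟨t, e⟩
  rw [sg_pow, two_mul, Finset.sum_range_add]
  have h := cs.simple_mul_simple_pow i j
  simp only [pow_add, h, one_mul, CharTwo.add_self_eq_zero]
  simp

/-- The signed permutation representation. -/
noncomputable def phi : W →* Equiv.Perm (W × ZMod 2) := cs.lift ⟨sg cs, sg_liftable cs⟩

open Classical in
lemma phi_word (ω : List B) (t : W) (e : ZMod 2) :
    phi cs (cs.wordProd ω) (t, e) =
      (cs.wordProd ω * t * (cs.wordProd ω)⁻¹, e + ((cs.rightInvSeq ω).count t : ZMod 2)) := by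
  induction ω with
  | nil => simp
  | cons i ω ih =>
    rw [wordProd_cons, map_mul, Equiv.Perm.mul_apply, ih]
    have : phi cs (cs.simple i) = sg cs i := by
      simp [phi]
    rw [this]
    have e1 : cs.wordProd ω * t * (cs.wordProd ω)⁻¹ = cs.simple i ↔
        (cs.wordProd ω)⁻¹ * cs.simple i * cs.wordProd ω = t := by
      constructor
      · intro h; rw [← h]; group
      · intro h; rw [← h]; group
    ext
    · simp [sg, mul_assoc]
    · simp only [sg, Equiv.coe_fn_mk, rightInvSeq, List.count_cons, e1, beq_iff_eq]
      push_cast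
      rw [add_assoc]

lemma exchange (ω : List B) (i : B) (h : cs.length (cs.wordProd ω * cs.simple i) <
    cs.length (cs.wordProd ω)) :
    ∃ j < ω.length, cs.wordProd ω * cs.simple i = cs.wordProd (ω.eraseIdx j) := by
  classical
  obtain ⟨ω', hr, hω'⟩ := cs.exists_isReduced (cs.wordProd ω * cs.simple i)
  have hw : cs.wordProd (ω'.concat i) = cs.wordProd ω := by
    rw [wordProd_concat, ← hω']; simp
  have hlen : cs.length (cs.wordProd ω) = ω'.length + 1 := by
    have := cs.length_mul_simple (cs.wordProd ω) i
    have h2 : cs.length (cs.wordProd ω * cs.simple i) = ω'.length := by rw [hω']; exact hr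
    omega
  have hr2 : cs.IsReduced (ω'.concat i) := by
    unfold CoxeterSystem.IsReduced
    rw [hw, hlen]; simp
  have hc : (cs.rightInvSeq (ω'.concat i)).count (cs.simple i) = 1 := by
    apply List.count_eq_one_of_mem (IsReduced.nodup_rightInvSeq cs hr2)
    rw [rightInvSeq_concat]; simp
  have h1 := phi_word cs (ω'.concat i) (cs.simple i) 0
  have h2 := phi_word cs ω (cs.simple i) 0
  rw [hw, h2, hc] at h1
  have h3 := congrArg Prod.snd h1
  simp only [zero_add, Nat.cast_one] at h3
  have hm : cs.simple i ∈ cs.rightInvSeq ω := by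
    by_contra hn
    rw [List.count_eq_zero_of_not_mem hn] at h3
    simp at h3
  obtain ⟨j, hj, hje⟩ := List.mem_iff_getElem.mp hm
  refine ⟨j, by simpa using hj, ?_⟩
  rw [← wordProd_mul_getD_rightInvSeq, List.getD_eq_getElem _ 1 hj, hje]

/-- Letters of the word lie in `K`. -/
def InK (K : Set W) (ω : List B) : Prop := ∀ i ∈ ω, cs.simple i ∈ K

lemma word_mem {K : Set W} {ω : List B} (h : InK cs K ω) :
    cs.wordProd ω ∈ Subgroup.closure K := by
  unfold wordProd
  apply Subgroup.list_prod_mem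
  intro x hx
  obtain ⟨i, hi, rfl⟩ := List.mem_map.mp hx
  exact Subgroup.subset_closure (h i hi)

lemma inK_erase {K : Set W} {ω : List B} (h : InK cs K ω) (j : ℕ) : InK cs K (ω.eraseIdx j) :=
  fun i hi => h i (List.mem_of_mem_eraseIdx hi)

lemma step {K : Set W} {ω : List B} (hK : InK cs K ω) (hr : cs.IsReduced ω) (i : B)
    (hi : cs.simple i ∈ K) :
    ∃ ω', InK cs K ω' ∧ cs.IsReduced ω' ∧ cs.wordProd ω * cs.simple i = cs.wordProd ω' := by
  rcases cs.length_mul_simple (cs.wordProd ω) i with h | h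
  · refine ⟨ω.concat i, ?_, ?_, by rw [wordProd_concat]⟩
    · intro k hk
      simp at hk
      rcases hk with hk | rfl
      · exact hK k hk
      · exact hi
    · unfold CoxeterSystem.IsReduced at *
      rw [wordProd_concat, h, hr]; simp
  · obtain ⟨j, hj, he⟩ := exchange cs ω i (by omega)
    refine ⟨ω.eraseIdx j, inK_erase cs hK j, ?_, he⟩
    unfold CoxeterSystem.IsReduced at *
    rw [← he]
    have := List.length_eraseIdx_add_one hj
    omega

lemma exists_word {K : Set W} (hK : K ⊆ Set.range cs.simple) {w : W}
    (hw : w ∈ Subgroup.closure K) :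
    ∃ ω, InK cs K ω ∧ cs.IsReduced ω ∧ w = cs.wordProd ω := by
  induction hw using Subgroup.closure_induction_right with
  | one => exact ⟨[], by simp [InK], by simp [CoxeterSystem.IsReduced], by simp⟩
  | mul_right x hx y hy ih =>
    obtain ⟨ω, h1, h2, rfl⟩ := ih
    obtain ⟨i, rfl⟩ := hK hy
    exact step cs h1 h2 i hy
  | mul_inv_cancel x hx y hy ih =>
    obtain ⟨ω, h1, h2, rfl⟩ := ih
    obtain ⟨i, rfl⟩ := hK hy
    rw [inv_simple]
    exact step cs h1 h2 i hy

lemma mem_of_closure {K : Set W} (hK : K ⊆ Set.range cs.simple) {t : W}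
    (ht : t ∈ Set.range cs.simple) (h : t ∈ Subgroup.closure K) : t ∈ K := by
  obtain ⟨i, rfl⟩ := ht
  obtain ⟨ω, h1, h2, h3⟩ := exists_word cs hK h
  have : ω.length = 1 := by
    rw [← h2.eq, ← h3]; simp
  obtain ⟨k, rfl⟩ := List.length_eq_one_iff.mp this
  rw [h3]; simpa using h1 k (by simp)

lemma length_up {K : Set W} (hK : K ⊆ Set.range cs.simple) {t w : W}
    (ht : t ∈ Set.range cs.simple) (htK : t ∉ K) (hw : w ∈ Subgroup.closure K) :
    cs.length (w * t) = cs.length w + 1 := by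
  obtain ⟨i, rfl⟩ := ht
  rcases cs.length_mul_simple w i with h | h
  · exact h
  · exfalso
    obtain ⟨ω, h1, h2, rfl⟩ := exists_word cs hK hw
    obtain ⟨j, hj, he⟩ := exchange cs ω i (by omega)
    apply htK
    apply mem_of_closure cs hK ⟨i, rfl⟩
    rw [← mul_mem_cancel_left (word_mem cs h1), he]
    exact word_mem cs (inK_erase cs h1 j)

/-- Maximal-length elements. -/
def IsMaxK (K : Set W) (w : W) : Prop :=
  w ∈ Subgroup.closure K ∧ ∀ u ∈ Subgroup.closure K, cs.length u ≤ cs.length w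

lemma max_aux {K : Set W} (hK : K ⊆ Set.range cs.simple) {w : W} (hw : IsMaxK cs K w)
    (ω : List B) (hω : InK cs K ω) (hr : cs.IsReduced ω) :
    ∃ v, w = v * cs.wordProd ω ∧ cs.length w = cs.length v + ω.length := by
  induction ω using List.reverseRecOn with
  | nil => exact ⟨w, by simp, by simp⟩
  | append_singleton ω i ih =>
    have hr' : cs.IsReduced ω := by
      have := hr.take ω.length
      simpa using this
    obtain ⟨v, hv, hl⟩ := ih (fun k hk => hω k (by simp [hk])) hr'
    have hi : cs.simple i ∈ K := hω i (by simp)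
    obtain ⟨α, hα, rfl⟩ := cs.exists_isReduced v
    have hlt : cs.length (w * cs.simple i) < cs.length w := by
      have h1 := hw.2 _ (mul_mem hw.1 (Subgroup.subset_closure hi))
      have h2 := cs.length_mul_simple_ne w i
      omega
    rw [← wordProd_append] at hv
    obtain ⟨j, hj, he⟩ := exchange cs (α ++ ω) i (by rw [← hv]; exact hlt)
    rw [← hv] at he
    have hadd := cs.length_mul_simple w i
    rcases lt_or_ge j α.length with hja | hja
    · rw [List.eraseIdx_append_of_lt_length hja] at he
      have hlw : w = cs.wordProd (α.eraseIdx j) * cs.wordProd (ω ++ [i]) := by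
        rw [wordProd_append] at he
        rw [wordProd_append, ← mul_assoc, ← he]; simp
      refine ⟨_, hlw, ?_⟩
      have a1 := List.length_eraseIdx_add_one hja
      have a2 := cs.length_wordProd_le (α.eraseIdx j)
      have a3 := cs.length_mul_le (cs.wordProd (α.eraseIdx j)) (cs.wordProd (ω ++ [i]))
      rw [← hlw, hr.eq] at a3
      rw [hα.eq] at hl
      simp at *
      omega
    · exfalso
      rw [List.eraseIdx_append_of_length_le hja, hv, wordProd_append, wordProd_append,
        mul_assoc] at he
      have he' := mul_left_cancel he
      have b1 : cs.wordProd (ω ++ [i]) = cs.wordProd (ω.eraseIdx (j - α.length)) := by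
        rw [wordProd_append, ← he']; simp
      have b2 := cs.length_wordProd_le (ω.eraseIdx (j - α.length))
      have b3 := hr.eq
      rw [b1] at b3
      have b4 := List.length_eraseIdx_le ω (j - α.length)
      simp at b3
      omega

section
variable {K : Set W} (hK : K ⊆ Set.range cs.simple) {w : W} (hw : IsMaxK cs K w)
include hK hw

lemma max_right {u : W} (hu : u ∈ Subgroup.closure K) :
    cs.length (w * u) + cs.length u = cs.length w := by
  obtain ⟨ω, h1, h2, h3⟩ := exists_word cs hK (inv_mem hu)
  obtain ⟨v, hv, hl⟩ := max_aux cs hK hw ω h1 h2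
  rw [← h3] at hv
  have : w * u = v := by rw [hv]; group
  rw [this, hl, ← h2.eq, ← h3, cs.length_inv]

lemma max_sq : w * w = 1 := by
  have := max_right cs hK hw hw.1
  exact cs.length_eq_zero_iff.mp (by omega)

lemma max_inv : w⁻¹ = w := inv_eq_of_mul_eq_one_left (max_sq cs hK hw)

lemma max_left {u : W} (hu : u ∈ Subgroup.closure K) :
    cs.length (u * w) + cs.length u = cs.length w := by
  have := max_right cs hK hw (inv_mem hu)
  rw [cs.length_inv u] at this
  rw [← cs.length_inv (u * w), mul_inv_rev, max_inv cs hK hw, this]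

lemma max_conj_length {u : W} (hu : u ∈ Subgroup.closure K) :
    cs.length (w * u * w) = cs.length u := by
  have h1 := max_left cs hK hw (mul_mem hw.1 hu)
  have h2 := max_right cs hK hw hu
  omega

lemma max_conj_conj (u : W) : w * (w * u * w) * w = u := by
  have h := max_sq cs hK hw
  rw [show w * (w * u * w) * w = (w * w) * u * (w * w) by group, h]; simp

lemma max_conj_mem {t : W} (ht : t ∈ K) : w * t * w ∈ K := by
  have hc := Subgroup.subset_closure ht
  have hl := max_conj_length cs hK hw hc
  obtain ⟨i, rfl⟩ := hK ht
  rw [cs.length_simple] at hl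
  obtain ⟨k, hk⟩ := cs.length_eq_one_iff.mp hl
  exact mem_of_closure cs hK ⟨k, hk.symm⟩ (mul_mem (mul_mem hw.1 hc) hw.1)

lemma max_unique {w' : W} (hw' : IsMaxK cs K w') : w' = w := by
  have h := max_right cs hK hw (mul_mem (inv_mem hw.1) hw'.1)
  rw [mul_inv_cancel_left] at h
  have h2 := hw'.2 w hw.1
  have h3 : w⁻¹ * w' = 1 := cs.length_eq_zero_iff.mp (by omega)
  exact (inv_mul_eq_one.mp h3).symm

lemma conj_closure {A A' : Set W} (h : ∀ t ∈ A, w * t * w ∈ A') {u : W}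
    (hu : u ∈ Subgroup.closure A) : w * u * w ∈ Subgroup.closure A' := by
  have hi := max_inv cs hK hw
  have : Subgroup.closure A ≤ (Subgroup.closure A').comap (MulAut.conj w).toMonoidHom := by
    rw [Subgroup.closure_le]
    intro t ht
    simp only [Subgroup.coe_comap, Set.mem_preimage, SetLike.mem_coe]
    simpa [hi] using Subgroup.subset_closure (h t ht)
  have h2 := this hu
  simpa [hi] using h2

lemma max_conj_max {A A' : Set W} (hA : A ⊆ K) (hA' : A' ⊆ K) (h : ∀ t ∈ A, w * t * w ∈ A')
    (h' : ∀ t ∈ A', w * t * w ∈ A) {a a' : W} (ha : IsMaxK cs A a) (ha' : IsMaxK cs A' a') :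
    a' = w * a * w := by
  refine (max_unique cs (hA'.trans hK) ha' ⟨conj_closure cs hK hw h ha.1, ?_⟩).symm
  intro u hu
  rw [max_conj_length cs hK hw (Subgroup.closure_mono hA ha.1),
    ← max_conj_length cs hK hw (Subgroup.closure_mono hA' hu)]
  exact ha.2 _ (conj_closure cs hK hw h' hu)

end

end Luo

theorem stmt_2 {B W : Type*} [Group W] [Finite W] {M : CoxeterMatrix B}
    (cs : CoxeterSystem M W)
    -- crystallographic condition: (W,S) is the Weyl group of a reduced root system
    (hcrys : ∀ i j : B, i ≠ j → M.M i j ∈ ({2, 3, 4, 6} : Set ℕ))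
    (S : Set W) (hS : S = Set.range cs.simple)
    -- longest elements of the standard parabolic subgroups
    (wl : Set W → W)
    (hwl : ∀ J ⊆ S, wl J ∈ Subgroup.closure J ∧
      ∀ u ∈ Subgroup.closure J, cs.length u ≤ cs.length (wl J))
    -- the bi-infinite Luo sequence
    (s : ℤ → W) (hmem : ∀ n : ℤ, s n ∈ S) (h01 : s 0 ≠ s 1)
    (hrec : ∀ n : ℤ, s (n + 1) = wl (S \ {s n}) * s (n - 1) * wl (S \ {s n}))
    -- m is the number of factors in Luo's decomposition
    (m : ℕ) (hm : 1 ≤ m)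
    (hfac : wl (S \ {s 0, s 1}) * wl S =
      ((List.range m).map
        (fun j => wl (S \ {s j, s (j + 1)}) * wl (S \ {s (j + 1)}))).prod)
    (hadd : cs.length (wl (S \ {s 0, s 1}) * wl S) =
      ∑ j ∈ Finset.range m,
        cs.length (wl (S \ {s j, s (j + 1)}) * wl (S \ {s (j + 1)}))) :
    (∀ i : ℤ, (wl S)⁻¹ * s i * wl S = s (i + m)) ∧
    (∀ i : ℤ, s (i + 2 * m) = s i) := by
  subst hS
  set S := Set.range cs.simple with hSdef
  have hmx : ∀ J ⊆ S, Luo.IsMaxK cs J (wl J) := hwl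
  have hJ : ∀ n, S \ {s n} ⊆ S := fun n => Set.sdiff_subset
  have hJ' : ∀ n, S \ {s n, s (n + 1)} ⊆ S := fun n => Set.sdiff_subset
  have hJJ : ∀ n, S \ {s n, s (n + 1)} ⊆ S \ {s n} := fun n =>
    Set.sdiff_subset_sdiff_right (by simp)
  have hJJ1 : ∀ n, S \ {s n, s (n + 1)} ⊆ S \ {s (n + 1)} := fun n =>
    Set.sdiff_subset_sdiff_right (by simp)
  have hSS : ∀ t ∈ S, wl S * t * wl S ∈ S := fun t ht =>
    Luo.max_conj_mem cs subset_rfl (hmx S subset_rfl) ht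
  have hS2 : wl S * wl S = 1 := Luo.max_sq cs subset_rfl (hmx S subset_rfl)
  have hScc : ∀ u, wl S * (wl S * u * wl S) * wl S = u :=
    Luo.max_conj_conj cs subset_rfl (hmx S subset_rfl)
  have hcl : ∀ u : W, u ∈ Subgroup.closure S := by
    intro u
    rw [hSdef, cs.subgroup_closure_range_simple]; trivial
  have hcc : ∀ n u, wl (S \ {s n}) * (wl (S \ {s n}) * u * wl (S \ {s n})) * wl (S \ {s n}) = u :=
    fun n => Luo.max_conj_conj cs (hJ n) (hmx _ (hJ n))
  have hback : ∀ n : ℤ, s (n - 1) = wl (S \ {s n}) * s (n + 1) * wl (S \ {s n}) := by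
    intro n; rw [hrec n, hcc]
  -- consecutive terms are distinct
  have hfwd : ∀ n, s (n - 1) ≠ s n → s n ≠ s (n + 1) := by
    intro n h h2
    have h3 : s (n + 1) ∈ S \ {s n} := by
      rw [hrec n]
      exact Luo.max_conj_mem cs (hJ n) (hmx _ (hJ n)) ⟨hmem _, by simpa using h⟩
    exact h3.2 (by simp [h2])
  have hbwd : ∀ n, s n ≠ s (n + 1) → s (n - 1) ≠ s n := by
    intro n h h2
    have h3 : s (n - 1) ∈ S \ {s n} := by
      rw [hback n]
      exact Luo.max_conj_mem cs (hJ n) (hmx _ (hJ n)) ⟨hmem _, by simpa using h.symm⟩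
    exact h3.2 (by simp [h2])
  have hne : ∀ n : ℤ, s n ≠ s (n + 1) := by
    intro n
    induction n using Int.induction_on with
    | zero => simpa using h01
    | succ k ih =>
      apply hfwd; simpa using ih
    | pred k ih =>
      have := hbwd _ ih
      simpa using this
  -- conjugation of the rank-two-less parabolics
  have hc1 : ∀ n : ℤ, ∀ t ∈ S \ {s n, s (n + 1)},
      wl (S \ {s (n + 1)}) * t * wl (S \ {s (n + 1)}) ∈ S \ {s (n + 1), s (n + 1 + 1)} := by
    intro n t ht
    have h1 := Luo.max_conj_mem cs (hJ (n + 1)) (hmx _ (hJ (n + 1))) (hJJ1 n ht)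
    refine ⟨h1.1, ?_⟩
    rintro (h | h)
    · exact h1.2 h
    · apply ht.2
      left
      rw [Set.mem_singleton_iff, hrec (n + 1)] at h
      have := congrArg (fun u => wl (S \ {s (n + 1)}) * u * wl (S \ {s (n + 1)})) h
      simp only [hcc] at this
      simpa using this
  have hc2 : ∀ n : ℤ, ∀ t ∈ S \ {s (n + 1), s (n + 1 + 1)},
      wl (S \ {s (n + 1)}) * t * wl (S \ {s (n + 1)}) ∈ S \ {s n, s (n + 1)} := by
    intro n t ht
    have h1 := Luo.max_conj_mem cs (hJ (n + 1)) (hmx _ (hJ (n + 1))) (hJJ (n + 1) ht)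
    refine ⟨h1.1, ?_⟩
    rintro (h | h)
    · apply ht.2
      right
      have e : s n = wl (S \ {s (n + 1)}) * s (n + 1 + 1) * wl (S \ {s (n + 1)}) := by
        have := hback (n + 1)
        simpa using this
      rw [e] at h
      have := congrArg (fun u => wl (S \ {s (n + 1)}) * u * wl (S \ {s (n + 1)})) h
      simp only [hcc] at this
      simpa using this
    · exact h1.2 h
  -- the factors
  set u : ℕ → W := fun j => wl (S \ {s j, s (j + 1)}) * wl (S \ {s (j + 1)}) with hu
  have hfac0 : wl (S \ {s 0, s 1}) * wl S = ((List.range m).map u).prod := by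
    rw [hfac]
    congr 1
    simp only [List.bind_eq_flatMap, List.pure_def]
    rw [← List.map_eq_flatMap, List.map_map]
    rfl
  clear hfac
  rename' hfac0 => hfac
  have hulen : ∀ j : ℕ, cs.length (u j) + cs.length (wl (S \ {s j, s (j + 1)})) =
      cs.length (wl (S \ {s (j + 1)})) := by
    intro j
    exact Luo.max_left cs (hJ _) (hmx _ (hJ _))
      (Subgroup.closure_mono (hJJ1 j) (hmx _ (hJ' j)).1)
  have hsq' : ∀ n : ℤ, (wl (S \ {s n, s (n + 1)}))⁻¹ = wl (S \ {s n, s (n + 1)}) := fun n =>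
    Luo.max_inv cs (hJ' n) (hmx _ (hJ' n))
  have hsq : ∀ n : ℤ, (wl (S \ {s n}))⁻¹ = wl (S \ {s n}) := fun n =>
    Luo.max_inv cs (hJ n) (hmx _ (hJ n))
  have hP : ∀ k : ℕ, ∀ t ∈ S \ {s 0, s 1},
      (((List.range k).map u).prod)⁻¹ * t * ((List.range k).map u).prod
        ∈ S \ {s k, s (k + 1)} := by
    intro k t ht
    induction k with
    | zero => simpa using ht
    | succ k ih =>
      rw [List.range_succ, List.map_append, List.prod_append]
      simp only [List.map_cons, List.map_nil, List.prod_cons, List.prod_nil, mul_one]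
      set P := ((List.range k).map u).prod
      have h1 := Luo.max_conj_mem cs (hJ' k) (hmx _ (hJ' k)) ih
      have h2 := hc1 k _ h1
      push_cast
      convert h2 using 1
      simp only [hu, mul_inv_rev, hsq, hsq']
      group
  have hset : ∀ r ∈ S \ {s 0, s 1}, wl S * r * wl S ∈ S \ {s (m : ℤ), s (m + 1)} := by
    intro r hr
    have h0 : S \ {s 0, s 1} ⊆ S := Set.sdiff_subset
    have h1 := hP m _ (Luo.max_conj_mem cs h0 (hmx _ h0) hr)
    rw [← hfac] at h1
    convert h1 using 1
    have hS1 : (wl S)⁻¹ = wl S := inv_eq_of_mul_eq_one_left hS2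
    have hz := Luo.max_sq cs h0 (hmx _ h0)
    rw [mul_inv_rev, hS1]
    rw [show ∀ a b : W, a * b⁻¹ * (b * r * b) * (b * a) = a * r * (b * b) * a by intros; group,
      hz, mul_one]
  have hin : ∀ t ∈ S, (t = s m ∨ t = s (m + 1)) →
      wl S * t * wl S = s 0 ∨ wl S * t * wl S = s 1 := by
    intro t ht h
    by_contra hn
    have h1 := hset (wl S * t * wl S) ⟨hSS t ht, by simpa using hn⟩
    rw [hScc] at h1
    exact h1.2 (by simpa using h)
  -- the key step
  have hkey : wl S * s (m + 1) * wl S = s 1 := by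
    obtain ⟨m', rfl⟩ : ∃ m', m = m' + 1 := ⟨m - 1, by omega⟩
    have hu0 : u 0 = wl (S \ {s 0, s 1}) * wl (S \ {s 1}) := by simp [hu]
    have hu0l : cs.length (u 0) + cs.length (wl (S \ {s 0, s 1})) =
        cs.length (wl (S \ {s 1})) := by simpa using hulen 0
    have hSl := Luo.max_left cs subset_rfl (hmx S subset_rfl) (hcl (wl (S \ {s 0, s 1})))
    have hSl1 := Luo.max_left cs subset_rfl (hmx S subset_rfl) (hcl (wl (S \ {s 1})))
    rw [Finset.sum_range_succ'] at hadd
    rw [List.range_succ_eq_map, List.map_cons, List.prod_cons, hu0, List.map_map, mul_assoc] at hfac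
    have hfac' := mul_left_cancel hfac
    have hQ : wl (S \ {s 1}) * wl S = ((List.range m').map (u ∘ Nat.succ)).prod := by
      rw [hfac', ← mul_assoc, Luo.max_sq cs (hJ 1) (hmx _ (hJ 1)), one_mul]
    have hadd' : cs.length (wl (S \ {s 0, s 1}) * wl S) =
      ∑ j ∈ Finset.range m', cs.length (u (j + 1)) + cs.length (u 0) := hadd
    have hQl : ∑ j ∈ Finset.range m', cs.length (u (j + 1)) + cs.length (wl (S \ {s 1})) =
      cs.length (wl S) := by omega
    have hlt : cs.length (wl (S \ {s 1})) < cs.length (wl S) := by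
      have h1 := Luo.length_up cs (hJ 1) (hmem 1) (by simp) (hmx _ (hJ 1)).1
      have h2 := (hmx S subset_rfl).2 _ (hcl (wl (S \ {s 1}) * s 1))
      omega
    rcases m' with _ | k
    · simp at hQl; omega
    · rw [Finset.sum_range_succ] at hQl
      rw [List.range_succ, List.map_append, List.prod_append] at hQ
      simp only [List.map_cons, List.map_nil, List.prod_cons, List.prod_nil, mul_one,
        Function.comp_apply, Nat.succ_eq_add_one] at hQ
      set R := ((List.range k).map (u ∘ Nat.succ)).prod with hR
      have hRl : cs.length R ≤ ∑ j ∈ Finset.range k, cs.length (u (j + 1)) := by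
        rw [hR]
        clear_value R
        clear hQ hQl hadd hadd' hfac hfac' hR hset hin hm R
        induction k with
        | zero => simp
        | succ k ih =>
          rw [Finset.sum_range_succ, List.range_succ, List.map_append, List.prod_append]
          refine (cs.length_mul_le _ _).trans ?_
          simpa using ih
      -- the last factor has `s (m+1)` as a right descent
      set n : ℤ := ((k + 1 : ℕ) : ℤ) with hn
      have hidx : (((k + 1 + 1 : ℕ) : ℤ) + 1) = n + 1 + 1 := by push_cast [hn]; ring
      rw [hidx]
      have hud : cs.length (u (k + 1) * s (n + 1 + 1)) + 1 = cs.length (u (k + 1)) := by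
        have e1 : u (k + 1) * s (n + 1 + 1) =
            (wl (S \ {s n, s (n + 1)}) * s n) * wl (S \ {s (n + 1)}) := by
          have e2 : u (k + 1) = wl (S \ {s n, s (n + 1)}) * wl (S \ {s (n + 1)}) := rfl
          have e3 := hrec (n + 1)
          rw [show n + 1 - 1 = n by ring] at e3
          rw [e2, e3]
          have e4 := Luo.max_sq cs (hJ (n + 1)) (hmx _ (hJ (n + 1)))
          rw [show ∀ a b c : W, a * b * (b * c * b) = a * (b * b) * c * b by intros; group, e4,
            mul_one]
        have e5 := Luo.length_up cs (hJ' n) (hmem n) (by simp) (hmx _ (hJ' n)).1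
        have e6 := Luo.max_left cs (hJ (n + 1)) (hmx _ (hJ (n + 1)))
          (u := wl (S \ {s n, s (n + 1)}) * s n)
          (mul_mem (Subgroup.closure_mono (hJJ1 n) (hmx _ (hJ' n)).1)
            (Subgroup.subset_closure ⟨hmem n, by simpa using hne n⟩))
        have e7 := hulen (k + 1)
        rw [← hn] at e7
        rw [e1]
        omega
      have hQs : cs.length (wl (S \ {s 1}) * wl S * s (n + 1 + 1)) <
          cs.length (wl (S \ {s 1}) * wl S) := by
        have f1 := cs.length_mul_le R (u (k + 1) * s (n + 1 + 1))
        rw [← mul_assoc, ← hQ] at f1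
        omega
      have hr := hSS _ (hmem (n + 1 + 1))
      set r := wl S * s (n + 1 + 1) * wl S with hrdef
      have f2 : wl (S \ {s 1}) * wl S * s (n + 1 + 1) = (wl (S \ {s 1}) * r) * wl S := by
        rw [hrdef, show ∀ a b c : W, a * (b * c * b) * b = a * b * c * (b * b) by intros; group,
          hS2, mul_one]
      have f3 := Luo.max_left cs subset_rfl (hmx S subset_rfl) (hcl (wl (S \ {s 1}) * r))
      rw [f2] at hQs
      by_contra hr1
      have f4 := (hmx _ (hJ 1)).2 _ (mul_mem (hmx _ (hJ 1)).1
        (Subgroup.subset_closure (⟨hr, by simpa using hr1⟩ : r ∈ S \ {s 1})))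
      omega
  have hkey0 : wl S * s m * wl S = s 0 := by
    rcases hin _ (hmem m) (Or.inl rfl) with h | h
    · exact h
    · exfalso
      apply hne m
      rw [← hkey] at h
      exact mul_left_cancel (mul_right_cancel h)
  have hS1 : (wl S)⁻¹ = wl S := inv_eq_of_mul_eq_one_left hS2
  have b0 : wl S * s 0 * wl S = s m := by rw [← hkey0, hScc]
  have b1 : wl S * s 1 * wl S = s (m + 1) := by rw [← hkey, hScc]
  -- star of the parabolic longest elements
  have hstar : ∀ n : ℤ, wl S * s n * wl S = s (n + m) →
      wl S * wl (S \ {s n}) * wl S = wl (S \ {s (n + m)}) := by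
    intro n hn
    symm
    refine Luo.max_conj_max cs subset_rfl (hmx S subset_rfl) (hJ _) (hJ _) ?_ ?_
      (hmx _ (hJ _)) (hmx _ (hJ _))
    · intro t ht
      refine ⟨hSS t ht.1, fun h => ht.2 ?_⟩
      rw [Set.mem_singleton_iff, ← hn] at h
      exact mul_left_cancel (mul_right_cancel h)
    · intro t ht
      refine ⟨hSS t ht.1, fun h => ht.2 ?_⟩
      rw [Set.mem_singleton_iff] at h
      rw [Set.mem_singleton_iff, ← hn, ← h, hScc]
  have hdist : ∀ a b : W, wl S * (a * b * a) * wl S =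
      (wl S * a * wl S) * (wl S * b * wl S) * (wl S * a * wl S) := by
    intro a b
    rw [show ∀ w : W, (w * a * w) * (w * b * w) * (w * a * w) =
      w * a * (w * w) * b * (w * w) * a * w by intros; group, hS2]
    group
  have hpair : ∀ i : ℤ, wl S * s i * wl S = s (i + m) ∧
      wl S * s (i + 1) * wl S = s (i + 1 + m) := by
    intro i
    induction i using Int.induction_on with
    | zero =>
      refine ⟨by simpa using b0, ?_⟩
      rw [show (0 : ℤ) + 1 = 1 by ring, b1, add_comm]
    | succ k ih =>
      refine ⟨ih.2, ?_⟩
      rw [hrec (k + 1), hdist, hstar _ ih.2, show (k : ℤ) + 1 - 1 = k by ring, ih.1,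
        show (k : ℤ) + 1 + 1 + m = (k + 1 + m) + 1 by ring, hrec (k + 1 + m),
        show (k : ℤ) + 1 + m - 1 = k + m by ring]
    | pred k ih =>
      refine ⟨?_, by simpa using ih.1⟩
      rw [hback (-k), hdist, hstar _ ih.1, ih.2,
        show -(k : ℤ) - 1 + m = (-k + m) - 1 by ring, hback (-k + m),
        show -(k : ℤ) + m + 1 = -k + 1 + m by ring]
  refine ⟨fun i => by rw [hS1]; exact (hpair i).1, fun i => ?_⟩
  rw [show i + 2 * (m : ℤ) = i + m + m by ring, ← (hpair (i + m)).1, ← (hpair i).1, hScc]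
end

section
/- Let I, J ⊆ S and w ∈ W satisfy w⁻¹ I w = J (as subsets of S), and suppose w has minimal length in the coset W_I w = w W_J. Then |P_I| = |P_J| and |P_I w P_J| = Q(w)·|P_I|, where Q(w) = |BwB|/|B|. -/
/-!
STATEMENT 8. Let G be a finite group with a BN-pair, with Weyl group W = N/(B ∩ N)
generated by the set S of involutions, and with standard parabolic subgroups
P_I = B W_I B for I ⊆ S. Let I, J ⊆ S and w ∈ W satisfy w⁻¹ I w = J (as subsets of S),
and suppose w has minimal length in the coset W_I w = w W_J. Then |P_I| = |P_J| and
|P_I w P_J| = Q(w)·|P_I|, where Q(w) = |BwB|/|B|.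
-/


open scoped Pointwise

variable {G : Type*} [Group G]

/-- The set of lifts in `G` of an element of the Weyl group `W = N/(B ⊓ N)` of a
BN-pair. (All statements about double cosets `BwB` are independent of the lift.) -/
def lifts (B N : Subgroup G) (w : ↥N ⧸ (B ⊓ N).subgroupOf N) : Set G :=
  {g : G | ∃ x : ↥N, QuotientGroup.mk x = w ∧ g = (x : G)}

/-- The double coset `BwB ⊆ G`, for `w` in the Weyl group. -/
def BwB (B N : Subgroup G) (w : ↥N ⧸ (B ⊓ N).subgroupOf N) : Set G :=
  (B : Set G) * lifts B N w * (B : Set G)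

/-- The standard parabolic subgroup `P_I = B W_I B ⊆ G` (as a subset of `G`),
for a subset `I` of the Weyl group. -/
def para (B N : Subgroup G) [((B ⊓ N).subgroupOf N).Normal] (I : Set (↥N ⧸ (B ⊓ N).subgroupOf N)) : Set G :=
  {g : G | ∃ w ∈ Subgroup.closure I, g ∈ BwB B N w}

/-- Word length with respect to a generating set `S`. -/
noncomputable def wordLen {W : Type*} [Monoid W] (S : Set W) (w : W) : ℕ :=
  sInf {m | ∃ L : List W, L.length = m ∧ (∀ x ∈ L, x ∈ S) ∧ L.prod = w}

/-- The element `a_{PwQ} = |Q|⁻¹ Σ_{x ∈ PwQ} x` of the group algebra `ℂG`. -/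
noncomputable def aPwQ [Fintype G] (B N : Subgroup G) (P : Set G)
    (w : ↥N ⧸ (B ⊓ N).subgroupOf N) (Q : Set G) : MonoidAlgebra ℂ G :=
  ((Q.ncard : ℂ))⁻¹ •
    ∑ x ∈ (Set.toFinite (P * lifts B N w * Q)).toFinset, MonoidAlgebra.single x (1 : ℂ)

/-- The idempotent `e_P = |P|⁻¹ Σ_{x ∈ P} x` of the group algebra `ℂG`. -/
noncomputable def ePset [Fintype G] (P : Set G) : MonoidAlgebra ℂ G :=
  ((P.ncard : ℂ))⁻¹ • ∑ x ∈ (Set.toFinite P).toFinset, MonoidAlgebra.single x (1 : ℂ)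

section helpers
variable {B N : Subgroup G}

theorem mem_BwB {w : ↥N ⧸ (B ⊓ N).subgroupOf N} {g : G} :
    g ∈ BwB B N w ↔ ∃ b ∈ B, ∃ n : N, QuotientGroup.mk n = w ∧ ∃ c ∈ B, g = b * n * c := by
  constructor
  · rintro ⟨_, ⟨b, hb, _, ⟨n, hn, rfl⟩, rfl⟩, c, hc, rfl⟩
    exact ⟨b, hb, n, hn, c, hc, rfl⟩
  · rintro ⟨b, hb, n, hn, c, hc, rfl⟩
    exact ⟨_, ⟨b, hb, _, ⟨n, hn, rfl⟩, rfl⟩, c, hc, rfl⟩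

theorem BwB_left {w : ↥N ⧸ (B ⊓ N).subgroupOf N} {g b : G} (hb : b ∈ B)
    (h : g ∈ BwB B N w) : b * g ∈ BwB B N w := by
  obtain ⟨b', hb', n, hn, c, hc, rfl⟩ := mem_BwB.1 h
  exact mem_BwB.2 ⟨b * b', mul_mem hb hb', n, hn, c, hc, by group⟩

theorem BwB_right {w : ↥N ⧸ (B ⊓ N).subgroupOf N} {g b : G} (hb : b ∈ B)
    (h : g ∈ BwB B N w) : g * b ∈ BwB B N w := by
  obtain ⟨b', hb', n, hn, c, hc, rfl⟩ := mem_BwB.1 h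
  exact mem_BwB.2 ⟨b', hb', n, hn, c * b, mul_mem hc hb, by group⟩

theorem BwB_rel {w : ↥N ⧸ (B ⊓ N).subgroupOf N} {g h : G}
    (hg : g ∈ BwB B N w) (hh : h ∈ BwB B N w) : ∃ b ∈ B, ∃ c ∈ B, h = b * g * c := by
  obtain ⟨b, hb, n, hn, c, hc, rfl⟩ := mem_BwB.1 hg
  obtain ⟨b', hb', n', hn', c', hc', rfl⟩ := mem_BwB.1 hh
  have : n⁻¹ * n' ∈ (B ⊓ N).subgroupOf N := QuotientGroup.eq.1 (hn.trans hn'.symm)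
  have h2 : (n : G)⁻¹ * n' ∈ B := (Subgroup.mem_subgroupOf.1 this).1
  refine ⟨b' * b⁻¹, mul_mem hb' (inv_mem hb), c⁻¹ * ((n : G)⁻¹ * n') * c',
    mul_mem (mul_mem (inv_mem hc) h2) hc', by group⟩

theorem BwB_transfer {v w : ↥N ⧸ (B ⊓ N).subgroupOf N} {g h : G}
    (hg : g ∈ BwB B N v) (hg' : g ∈ BwB B N w) (hh : h ∈ BwB B N v) : h ∈ BwB B N w := by
  obtain ⟨b, hb, c, hc, rfl⟩ := BwB_rel hg hh
  exact BwB_right hc (BwB_left hb hg')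

variable [((B ⊓ N).subgroupOf N).Normal]

theorem BwB_inv {w : ↥N ⧸ (B ⊓ N).subgroupOf N} {g : G}
    (h : g ∈ BwB B N w) : g⁻¹ ∈ BwB B N w⁻¹ := by
  obtain ⟨b, hb, n, rfl, c, hc, rfl⟩ := mem_BwB.1 h
  exact mem_BwB.2 ⟨c⁻¹, inv_mem hc, n⁻¹, rfl, b⁻¹, inv_mem hb, by simp [mul_assoc]⟩

theorem BwB_one {g : G} : g ∈ BwB B N 1 ↔ g ∈ B := by
  constructor
  · intro h
    obtain ⟨b, hb, n, hn, c, hc, rfl⟩ := mem_BwB.1 h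
    have := (QuotientGroup.eq_one_iff n).1 hn
    exact mul_mem (mul_mem hb (Subgroup.mem_subgroupOf.1 this).1) hc
  · intro h
    exact mem_BwB.2 ⟨g, h, 1, rfl, 1, one_mem _, by simp⟩

theorem BwB_split {v w : ↥N ⧸ (B ⊓ N).subgroupOf N} {g : G} (h : g ∈ BwB B N (v * w)) :
    ∃ a ∈ BwB B N v, ∃ c ∈ BwB B N w, g = a * c := by
  obtain ⟨b, hb, n, hn, c, hc, rfl⟩ := mem_BwB.1 h
  obtain ⟨m, rfl⟩ := QuotientGroup.mk_surjective v
  refine ⟨b * m, mem_BwB.2 ⟨b, hb, m, rfl, 1, one_mem _, by simp⟩,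
    (m⁻¹ * n : N) * c, mem_BwB.2 ⟨1, one_mem _, m⁻¹ * n, ?_, c, hc, by simp⟩, by simp [mul_assoc]⟩
  rw [QuotientGroup.mk_mul, hn]; simp

theorem BwB_nonempty (w : ↥N ⧸ (B ⊓ N).subgroupOf N) : ∃ g, g ∈ BwB B N w := by
  obtain ⟨m, rfl⟩ := QuotientGroup.mk_surjective w
  exact ⟨m, mem_BwB.2 ⟨1, one_mem _, m, rfl, 1, one_mem _, by simp⟩⟩

/-- Multiplication axiom in elementwise form. -/
def MulAx (B N : Subgroup G) [((B ⊓ N).subgroupOf N).Normal]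
    (S : Set (↥N ⧸ (B ⊓ N).subgroupOf N)) : Prop :=
  ∀ s ∈ S, ∀ v, ∀ a ∈ BwB B N s, ∀ c ∈ BwB B N v, a * c ∈ BwB B N (s * v) ∨ a * c ∈ BwB B N v

variable {S : Set (↥N ⧸ (B ⊓ N).subgroupOf N)}

theorem mulAx_of (hBN1 : ∀ s ∈ S, ∀ w : ↥N ⧸ (B ⊓ N).subgroupOf N,
      lifts B N s * (B : Set G) * lifts B N w ⊆ BwB B N (s * w) ∪ BwB B N w) : MulAx B N S := by
  intro s hs v a ha c hc
  obtain ⟨b, hb, n, hn, b', hb', rfl⟩ := mem_BwB.1 ha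
  obtain ⟨d, hd, m, hm, d', hd', rfl⟩ := mem_BwB.1 hc
  have : (n : G) * (b' * d) * m ∈ BwB B N (s * v) ∪ BwB B N v :=
    hBN1 s hs v ⟨_, ⟨_, ⟨n, hn, rfl⟩, _, mul_mem hb' hd, rfl⟩, _, ⟨m, hm, rfl⟩, rfl⟩
  have e : b * (n : G) * b' * (d * m * d') = b * ((n : G) * (b' * d) * m) * d' := by group
  rw [e]
  exact this.imp (fun h => BwB_right hd' (BwB_left hb h)) (fun h => BwB_right hd' (BwB_left hb h))

theorem MulAx.right (H : MulAx B N S) (hS : ∀ s ∈ S, s⁻¹ = s) {s} (hs : s ∈ S) {v} {a c : G}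
    (ha : a ∈ BwB B N v) (hc : c ∈ BwB B N s) :
    a * c ∈ BwB B N (v * s) ∨ a * c ∈ BwB B N v := by
  have hc' := BwB_inv hc
  rw [hS s hs] at hc'
  have := H s hs v⁻¹ _ hc' _ (BwB_inv ha)
  refine this.imp (fun h => ?_) (fun h => ?_)
  · have := BwB_inv h
    simpa [hS s hs] using this
  · have := BwB_inv h
    simpa using this

theorem MulAx.inj_aux (H : MulAx B N S) (hS : ∀ s ∈ S, s⁻¹ = s)
    (L : List (↥N ⧸ (B ⊓ N).subgroupOf N)) :
    (∀ x ∈ L, x ∈ S) → ∀ w, (∀ M : List (↥N ⧸ (B ⊓ N).subgroupOf N),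
      (∀ x ∈ M, x ∈ S) → M.prod = w → L.length ≤ M.length) →
    ∀ g, g ∈ BwB B N L.prod → g ∈ BwB B N w → L.prod = w := by
  induction L with
  | nil =>
    intro _ w _ g h1 h2
    rw [List.prod_nil] at h1 ⊢
    obtain ⟨n, rfl⟩ := QuotientGroup.mk_surjective w
    have h3 : (n : G) ∈ BwB B N (n : ↥N ⧸ (B ⊓ N).subgroupOf N) :=
      mem_BwB.2 ⟨1, one_mem _, n, rfl, 1, one_mem _, by simp⟩
    have := BwB_one.1 (BwB_transfer h2 h1 h3)
    symm
    exact (QuotientGroup.eq_one_iff n).2 (Subgroup.mem_subgroupOf.2 ⟨this, n.2⟩)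
  | cons s L ih =>
    intro hL w hw g h1 h2
    have hs : s ∈ S := hL s (by simp)
    have hL' : ∀ x ∈ L, x ∈ S := fun x hx => hL x (by simp [hx])
    rw [List.prod_cons] at h1 ⊢
    obtain ⟨a, ha, c, hc, rfl⟩ := BwB_split h1
    have ha' := BwB_inv ha
    rw [hS s hs] at ha'
    have := H s hs w _ ha' _ h2
    rw [inv_mul_cancel_left] at this
    have ss : ∀ x, s * (s * x) = x := fun x => by
      have := hS s hs
      nth_rewrite 1 [← this]; simp
    rcases this with h | h
    · have := ih hL' (s * w) (fun M hM hp => by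
        have := hw (s :: M) (by simpa [hs] using hM) (by rw [List.prod_cons, hp, ss])
        simpa using this) c hc h
      rw [this, ss]
    · have := ih hL' w (fun M hM hp => by
        have := hw M hM hp
        simp at this; omega) c hc h
      have := hw L hL' this
      simp at this

theorem exists_word (hS : ∀ s ∈ S, s⁻¹ = s) {w : ↥N ⧸ (B ⊓ N).subgroupOf N}
    (hw : w ∈ Subgroup.closure S) : ∃ L : List (↥N ⧸ (B ⊓ N).subgroupOf N),
      (∀ x ∈ L, x ∈ S) ∧ L.prod = w := by
  rw [← Subgroup.mem_toSubmonoid, Subgroup.closure_toSubmonoid] at hw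
  obtain ⟨L, hL, h⟩ := Submonoid.exists_list_of_mem_closure hw
  refine ⟨L, fun x hx => ?_, h⟩
  rcases hL x hx with h | h
  · exact h
  · have h' : x⁻¹ ∈ S := h
    have := hS _ h'
    rw [inv_inv] at this
    rwa [this]

theorem exists_min_word (hS : ∀ s ∈ S, s⁻¹ = s) {w : ↥N ⧸ (B ⊓ N).subgroupOf N}
    (hw : w ∈ Subgroup.closure S) : ∃ L : List (↥N ⧸ (B ⊓ N).subgroupOf N),
      (∀ x ∈ L, x ∈ S) ∧ L.prod = w ∧ L.length = wordLen S w := by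
  obtain ⟨L, hL, h⟩ := exists_word hS hw
  have : wordLen S w ∈ {m | ∃ L : List (↥N ⧸ (B ⊓ N).subgroupOf N),
    L.length = m ∧ (∀ x ∈ L, x ∈ S) ∧ L.prod = w} := Nat.sInf_mem ⟨_, L, rfl, hL, h⟩
  obtain ⟨M, h1, h2, h3⟩ := this
  exact ⟨M, h2, h3, h1⟩

theorem wordLen_le {L : List (↥N ⧸ (B ⊓ N).subgroupOf N)} (h : ∀ x ∈ L, x ∈ S) :
    wordLen S L.prod ≤ L.length := Nat.sInf_le ⟨L, rfl, h, rfl⟩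

theorem MulAx.inj (H : MulAx B N S) (hS : ∀ s ∈ S, s⁻¹ = s) (hg : Subgroup.closure S = ⊤)
    {v w} {g : G} (h1 : g ∈ BwB B N v) (h2 : g ∈ BwB B N w) : v = w := by
  wlog hle : wordLen S v ≤ wordLen S w generalizing v w
  · exact (this h2 h1 (le_of_not_ge hle)).symm
  obtain ⟨L, hL, rfl, hl⟩ := exists_min_word hS (w := v) (by rw [hg]; trivial)
  refine H.inj_aux hS L hL w (fun M hM hp => ?_) g h1 h2
  subst hp
  exact hl.trans_le (hle.trans (wordLen_le hM))

theorem MulAx.sub (H : MulAx B N S) (hS : ∀ s ∈ S, s⁻¹ = s)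
    (L : List (↥N ⧸ (B ⊓ N).subgroupOf N)) :
    (∀ x ∈ L, x ∈ S) → ∀ z, ∀ a ∈ BwB B N z, ∀ c ∈ BwB B N L.prod,
      ∃ M : List (↥N ⧸ (B ⊓ N).subgroupOf N), M.Sublist L ∧ a * c ∈ BwB B N (z * M.prod) := by
  induction L with
  | nil =>
    intro _ z a ha c hc
    exact ⟨[], List.Sublist.refl _, by simpa using BwB_right (BwB_one.1 hc) ha⟩
  | cons t L ih =>
    intro hL z a ha c hc
    rw [List.prod_cons] at hc
    obtain ⟨p, hp, q, hq, rfl⟩ := BwB_split hc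
    have hL' : ∀ x ∈ L, x ∈ S := fun x hx => hL x (by simp [hx])
    rw [← mul_assoc]
    rcases H.right hS (hL t (by simp)) ha hp with h | h
    · obtain ⟨M, hM, hm⟩ := ih hL' _ _ h _ hq
      exact ⟨t :: M, hM.cons_cons t, by simpa [mul_assoc] using hm⟩
    · obtain ⟨M, hM, hm⟩ := ih hL' _ _ h _ hq
      exact ⟨M, hM.cons t, hm⟩

theorem MulAx.para_mul (H : MulAx B N S) (hS : ∀ s ∈ S, s⁻¹ = s)
    {I : Set (↥N ⧸ (B ⊓ N).subgroupOf N)} (hI : I ⊆ S) {a : G} (ha : a ∈ para B N I)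
    {v} {c : G} (hc : c ∈ BwB B N v) : ∃ x ∈ Subgroup.closure I, a * c ∈ BwB B N (x * v) := by
  obtain ⟨y, hy, ha⟩ := ha
  obtain ⟨L, hL, rfl⟩ := exists_word (fun s hs => hS s (hI hs)) hy
  clear hy
  induction L generalizing a with
  | nil => exact ⟨1, one_mem _, by simpa using BwB_left (BwB_one.1 ha) hc⟩
  | cons t L ih =>
    rw [List.prod_cons] at ha
    obtain ⟨p, hp, q, hq, rfl⟩ := BwB_split ha
    obtain ⟨x, hx, h⟩ := ih (a := q) (fun x hx => hL x (by simp [hx])) hq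
    have ht : t ∈ I := hL t (by simp)
    rcases H t (hI ht) _ _ hp _ h with h | h
    · exact ⟨t * x, mul_mem (Subgroup.subset_closure ht) hx, by simpa [mul_assoc] using h⟩
    · exact ⟨x, hx, by simpa [mul_assoc] using h⟩

theorem para_inv {I : Set (↥N ⧸ (B ⊓ N).subgroupOf N)} {a : G} (ha : a ∈ para B N I) :
    a⁻¹ ∈ para B N I := by
  obtain ⟨y, hy, ha⟩ := ha
  exact ⟨y⁻¹, inv_mem hy, BwB_inv ha⟩

theorem MulAx.para_mul_mem (H : MulAx B N S) (hS : ∀ s ∈ S, s⁻¹ = s)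
    {I : Set (↥N ⧸ (B ⊓ N).subgroupOf N)} (hI : I ⊆ S) {a c : G} (ha : a ∈ para B N I)
    (hc : c ∈ para B N I) : a * c ∈ para B N I := by
  obtain ⟨y, hy, hc⟩ := hc
  obtain ⟨x, hx, h⟩ := H.para_mul hS hI ha hc
  exact ⟨x * y, mul_mem hx hy, h⟩

theorem MulAx.mul_para (H : MulAx B N S) (hS : ∀ s ∈ S, s⁻¹ = s)
    {I : Set (↥N ⧸ (B ⊓ N).subgroupOf N)} (hI : I ⊆ S) {a : G} (ha : a ∈ para B N I)
    {v} {c : G} (hc : c ∈ BwB B N v) : ∃ x ∈ Subgroup.closure I, c * a ∈ BwB B N (v * x) := by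
  obtain ⟨x, hx, h⟩ := H.para_mul hS hI (para_inv ha) (BwB_inv hc)
  refine ⟨x⁻¹, inv_mem hx, ?_⟩
  simpa using BwB_inv h

theorem card_mul_aux [Finite G] (B : Subgroup G) (X Y : Set G)
    (hX : ∀ x ∈ X, ∀ b ∈ B, x * b ∈ X) (hY : ∀ y ∈ Y, ∀ b ∈ B, b * y ∈ Y)
    (h : ∀ x ∈ X, ∀ x' ∈ X, ∀ y ∈ Y, ∀ y' ∈ Y, x * y = x' * y' → x⁻¹ * x' ∈ B) :
    (X * Y).ncard * (B : Set G).ncard = X.ncard * Y.ncard := by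
  have key : ∀ z : G, ∃ p : G × G, z ∈ X * Y → p.1 ∈ X ∧ p.2 ∈ Y ∧ p.1 * p.2 = z := by
    intro z
    by_cases hz : z ∈ X * Y
    · obtain ⟨x, hx, y, hy, rfl⟩ := hz
      exact ⟨(x, y), fun _ => ⟨hx, hy, rfl⟩⟩
    · exact ⟨(1, 1), fun h => absurd h hz⟩
  choose f hf using key
  rw [← Set.ncard_prod, ← Set.ncard_prod]
  refine Set.ncard_congr (fun p _ => ((f p.1).1 * p.2, p.2⁻¹ * (f p.1).2)) ?_ ?_ ?_
  · rintro ⟨z, b⟩ ⟨hz, hb⟩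
    obtain ⟨h1, h2, h3⟩ := hf z hz
    exact ⟨hX _ h1 _ hb, hY _ h2 _ (inv_mem hb)⟩
  · rintro ⟨z, b⟩ ⟨z', b'⟩ ⟨hz, hb⟩ ⟨hz', hb'⟩ e
    obtain ⟨h1, h2, h3⟩ := hf z hz
    obtain ⟨h1', h2', h3'⟩ := hf z' hz'
    simp only [Prod.mk.injEq] at e
    have : z = z' := by
      calc z = ((f z).1 * b) * (b⁻¹ * (f z).2) := by rw [← h3]; simp [h3, mul_assoc]
        _ = ((f z').1 * b') * (b'⁻¹ * (f z').2) := by rw [e.1, e.2]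
        _ = z' := by simp [h3', mul_assoc]
    subst this
    simpa using e.1
  · rintro ⟨x, y⟩ ⟨hx, hy⟩
    have hz : x * y ∈ X * Y := Set.mul_mem_mul hx hy
    obtain ⟨h1, h2, h3⟩ := hf _ hz
    refine ⟨(x * y, (f (x * y)).1⁻¹ * x), ⟨hz, h _ h1 _ hx _ h2 _ hy h3⟩, ?_⟩
    simp only [Prod.mk.injEq]
    refine ⟨by simp, ?_⟩
    rw [mul_inv_rev, inv_inv, mul_assoc, h3]; simp

theorem MulAx.card [Finite G] (H : MulAx B N S) (hS : ∀ s ∈ S, s⁻¹ = s)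
    (hg : Subgroup.closure S = ⊤)
    {I : Set (↥N ⧸ (B ⊓ N).subgroupOf N)} (hI : I ⊆ S)
    (L : List (↥N ⧸ (B ⊓ N).subgroupOf N)) (hL : ∀ x ∈ L, x ∈ S)
    (hmin : ∀ x ∈ Subgroup.closure I, ∀ M : List (↥N ⧸ (B ⊓ N).subgroupOf N),
      (∀ x ∈ M, x ∈ S) → M.prod = x * L.prod → L.length ≤ M.length) :
    {g | ∃ x ∈ Subgroup.closure I, g ∈ BwB B N (x * L.prod)}.ncard * (B : Set G).ncard =
      (para B N I).ncard * (BwB B N L.prod).ncard := by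
  rw [← card_mul_aux B (para B N I) (BwB B N L.prod)]
  · congr 2
    ext g
    constructor
    · rintro ⟨x, hx, h⟩
      obtain ⟨a, ha, c, hc, rfl⟩ := BwB_split h
      exact ⟨a, ⟨x, hx, ha⟩, c, hc, rfl⟩
    · rintro ⟨a, ha, c, hc, rfl⟩
      exact H.para_mul hS hI ha hc
  · rintro x ⟨u, hu, hx⟩ b hb
    exact ⟨u, hu, BwB_right hb hx⟩
  · intro y hy b hb
    exact BwB_left hb hy
  · intro x hx x' hx' y hy y' hy' e
    obtain ⟨z, hz, h⟩ := H.para_mul_mem hS hI (para_inv hx) hx'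
    obtain ⟨M, hM, hm⟩ := H.sub hS L hL z _ h _ hy'
    have e' : x⁻¹ * x' * y' = y := by rw [mul_assoc, ← e]; simp
    rw [e'] at hm
    have h1 := H.inj hS hg hm hy
    have := hmin z⁻¹ (inv_mem hz) M (fun x hx => hL x (hM.subset hx)) (by rw [← h1]; simp)
    have := hM.eq_of_length_le this
    subst this
    have : z = 1 := by simpa using h1
    subst this
    exact BwB_one.1 h

end helpers

theorem stmt_8 [Fintype G] (B N : Subgroup G) [((B ⊓ N).subgroupOf N).Normal]
    -- BN-pair axioms
    (hGN : Subgroup.closure ((B : Set G) ∪ (N : Set G)) = ⊤)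
    (S : Set (↥N ⧸ (B ⊓ N).subgroupOf N))
    (hSgen : Subgroup.closure S = ⊤)
    (hSinv : ∀ s ∈ S, s * s = 1 ∧ s ≠ 1)
    (hBN1 : ∀ s ∈ S, ∀ w : ↥N ⧸ (B ⊓ N).subgroupOf N,
      lifts B N s * (B : Set G) * lifts B N w ⊆ BwB B N (s * w) ∪ BwB B N w)
    (hBN2 : ∀ s ∈ S, ¬(lifts B N s * (B : Set G) * lifts B N s ⊆ (B : Set G)))
    -- the data of the statement
    (I J : Set (↥N ⧸ (B ⊓ N).subgroupOf N)) (hI : I ⊆ S) (hJ : J ⊆ S)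
    (w : ↥N ⧸ (B ⊓ N).subgroupOf N)
    (hconj : (fun x => w⁻¹ * x * w) '' I = J)
    (hmin : ∀ x ∈ Subgroup.closure I, wordLen S w ≤ wordLen S (x * w)) :
    (para B N I).ncard = (para B N J).ncard ∧
    ((para B N I * lifts B N w * para B N J).ncard : ℚ) =
      (((BwB B N w).ncard : ℚ) / ((B : Set G).ncard : ℚ)) * ((para B N I).ncard : ℚ) := by
  have hS : ∀ s ∈ S, s⁻¹ = s := fun s hs => inv_eq_of_mul_eq_one_left (hSinv s hs).1
  have H : MulAx B N S := mulAx_of hBN1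
  obtain ⟨L, hL, hp, hl⟩ := exists_min_word hS (w := w) (by rw [hSgen]; trivial)
  have hrev : ∀ M : List (↥N ⧸ (B ⊓ N).subgroupOf N), (∀ x ∈ M, x ∈ S) →
      M.reverse.prod = M.prod⁻¹ := by
    intro M hM
    rw [List.prod_inv_reverse]
    congr 2
    conv_lhs => rw [← List.map_id M]
    exact List.map_congr_left (fun x hx => (hS x (hM x hx)).symm)
  -- conjugation
  have c1 : ∀ x ∈ Subgroup.closure I, w⁻¹ * x * w ∈ Subgroup.closure J := by
    intro x hx
    induction hx using Subgroup.closure_induction with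
    | mem x hx => exact Subgroup.subset_closure (hconj ▸ ⟨x, hx, rfl⟩)
    | one => simp
    | mul x y _ _ h1 h2 =>
      have := mul_mem h1 h2
      simpa [mul_assoc] using this
    | inv x _ h =>
      have := inv_mem h
      simpa [mul_assoc] using this
  have c2 : ∀ y ∈ Subgroup.closure J, w * y * w⁻¹ ∈ Subgroup.closure I := by
    intro y hy
    induction hy using Subgroup.closure_induction with
    | mem y hy =>
      rw [← hconj] at hy
      obtain ⟨x, hx, rfl⟩ := hy
      exact Subgroup.subset_closure (by simpa [mul_assoc] using hx)
    | one => simp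
    | mul x y _ _ h1 h2 =>
      have := mul_mem h1 h2
      simpa [mul_assoc] using this
    | inv x _ h =>
      have := inv_mem h
      simpa [mul_assoc] using this
  have hmin' : ∀ x ∈ Subgroup.closure I, ∀ M : List (↥N ⧸ (B ⊓ N).subgroupOf N),
      (∀ x ∈ M, x ∈ S) → M.prod = x * L.prod → L.length ≤ M.length := by
    intro x hx M hM h
    rw [hl]
    refine (hmin x hx).trans ?_
    rw [← hp, ← h]
    exact wordLen_le hM
  have k1 := H.card hS hSgen hI L hL hmin'
  have k2 := H.card hS hSgen hJ L.reverse (by simpa using hL) (by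
    intro y hy M hM h
    rw [hrev L hL, hp] at h
    have := hmin' (w * y⁻¹ * w⁻¹) (c2 _ (inv_mem hy)) M.reverse (by simpa using hM) (by
      rw [hrev M hM, h, hp]; simp)
    simpa using this)
  rw [hrev L hL, hp] at k2
  rw [hp] at k1
  have e1 : (BwB B N w⁻¹).ncard = (BwB B N w).ncard := by
    rw [← Set.ncard_inv (BwB B N w)]
    congr 1
    ext g
    rw [Set.mem_inv]
    exact ⟨fun h => by simpa using BwB_inv h, fun h => by simpa using BwB_inv h⟩
  have e2 : {g | ∃ x ∈ Subgroup.closure J, g ∈ BwB B N (x * w⁻¹)}.ncard =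
      {g | ∃ x ∈ Subgroup.closure I, g ∈ BwB B N (x * w)}.ncard := by
    rw [← Set.ncard_inv {g | ∃ x ∈ Subgroup.closure I, g ∈ BwB B N (x * w)}]
    congr 1
    ext g
    rw [Set.mem_inv]
    constructor
    · rintro ⟨y, hy, h⟩
      refine ⟨w * y⁻¹ * w⁻¹, c2 _ (inv_mem hy), ?_⟩
      simpa using BwB_inv h
    · rintro ⟨x, hx, h⟩
      refine ⟨w⁻¹ * x⁻¹ * w, c1 _ (inv_mem hx), ?_⟩
      simpa using BwB_inv h
  have e3 : para B N I * lifts B N w * para B N J =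
      {g | ∃ x ∈ Subgroup.closure I, g ∈ BwB B N (x * w)} := by
    ext g
    constructor
    · rintro ⟨_, ⟨p, hp', _, ⟨n, hn, rfl⟩, rfl⟩, q, hq, rfl⟩
      have hn' : (n : G) ∈ BwB B N w := mem_BwB.2 ⟨1, one_mem _, n, hn, 1, one_mem _, by simp⟩
      obtain ⟨y, hy, h⟩ := H.mul_para hS hJ hq hn'
      obtain ⟨x, hx, h'⟩ := H.para_mul hS hI hp' h
      refine ⟨x * (w * y * w⁻¹), mul_mem hx (c2 y hy), ?_⟩
      simpa [mul_assoc] using h'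
    · rintro ⟨x, hx, h⟩
      obtain ⟨a, ha, c, hc, rfl⟩ := BwB_split h
      obtain ⟨b, hb, n, hn, b', hb', rfl⟩ := mem_BwB.1 hc
      refine ⟨_, ⟨a * b, ⟨x, hx, BwB_right hb ha⟩, _, ⟨n, hn, rfl⟩, rfl⟩, b',
        ⟨1, one_mem _, BwB_one.2 hb'⟩, ?_⟩
      simp [mul_assoc]
  have pw : 0 < (BwB B N w).ncard := (Set.ncard_pos (Set.toFinite _)).2 (BwB_nonempty w)
  have pB : 0 < (B : Set G).ncard := (Set.ncard_pos (Set.toFinite _)).2 ⟨1, one_mem B⟩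
  rw [e1, e2, k1] at k2
  refine ⟨Nat.eq_of_mul_eq_mul_right pw k2, ?_⟩
  rw [e3]
  have pB' : ((B : Set G).ncard : ℚ) ≠ 0 := by exact_mod_cast pB.ne'
  have k1' := congrArg (Nat.cast : ℕ → ℚ) k1
  push_cast at k1'
  rw [div_mul_eq_mul_div, eq_div_iff pB', k1', mul_comm]
end
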